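/- arXiv:2502.13235 — 2 statements merged into one kernel-verified Lean document; each statement's English description precedes it below -/
import Mathlib

section
/- Let G be a commutative group with two compatible partial orders ≤ and ⪯. Then the following are equivalent: (a) G is a mixed lattice group; (b) for all x, y ∈ G the set {w ∈ G : 0 ⪯ w and y ≤ w + x} has a least element m with respect to ≤; (c) for all x, y ∈ G the set {w ∈ G : 0 ≤ w and y ⪯ w + x} has a least element r with respect to ≤. Moreover, in case (b) the least element is m = x ⩖ y − x = y − y ⩗ x, and in case (c) the least element is r = y ⩖ x − x = y − x ⩗ y. -/
/-- A commutative monoid equipped with two partial orders (the initial order `le` = `≤`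
and the specific order `sle` = `⪯`), each compatible with addition. -/
structure TwoOrders (M : Type*) [AddCommMonoid M] where
  le : M → M → Prop
  sle : M → M → Prop
  le_refl : ∀ x, le x x
  le_antisymm : ∀ x y, le x y → le y x → x = y
  le_trans : ∀ x y z, le x y → le y z → le x z
  sle_refl : ∀ x, sle x x
  sle_antisymm : ∀ x y, sle x y → sle y x → x = y
  sle_trans : ∀ x y z, sle x y → sle y z → sle x z
  add_le_add : ∀ x y w, le x y → le (x + w) (y + w)
  add_sle_add : ∀ x y w, sle x y → sle (x + w) (y + w)

/-- `w` is the mixed upper envelope `u ⩖ v`, i.e. the least element (w.r.t. `le`) of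
`{w : sle u w ∧ le v w}`. -/
def TwoOrders.IsUpperEnv {M : Type*} [AddCommMonoid M] (O : TwoOrders M) (u v w : M) : Prop :=
  O.sle u w ∧ O.le v w ∧ ∀ z, O.sle u z → O.le v z → O.le w z

/-- `w` is the mixed lower envelope `u ⩗ v`, i.e. the greatest element (w.r.t. `le`) of
`{w : sle w u ∧ le w v}`. -/
def TwoOrders.IsLowerEnv {M : Type*} [AddCommMonoid M] (O : TwoOrders M) (u v w : M) : Prop :=
  O.sle w u ∧ O.le w v ∧ ∀ z, O.sle z u → O.le z v → O.le z w

/-- An A-structure: naturally ordered w.r.t. `sle`, strong cancellation for `le`,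
and all mixed upper envelopes exist. -/
def TwoOrders.IsAStructure {M : Type*} [AddCommMonoid M] (O : TwoOrders M) : Prop :=
  (∀ u v, O.sle u v ↔ ∃ w, v = u + w) ∧
  (∀ u v w, O.le u v ↔ O.le (u + w) (v + w)) ∧
  (∀ u v, ∃ w, O.IsUpperEnv u v w)

/-- A B-structure: naturally ordered w.r.t. `le`, strong cancellation for `sle`,
and all mixed upper envelopes exist. -/
def TwoOrders.IsBStructure {M : Type*} [AddCommMonoid M] (O : TwoOrders M) : Prop :=
  (∀ u v, O.le u v ↔ ∃ w, v = u + w) ∧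
  (∀ u v w, O.sle u v ↔ O.sle (u + w) (v + w)) ∧
  (∀ u v, ∃ w, O.IsUpperEnv u v w)

/-- A mixed lattice group: all mixed upper and lower envelopes exist. -/
def TwoOrders.IsMLG {M : Type*} [AddCommMonoid M] (O : TwoOrders M) : Prop :=
  (∀ u v, ∃ w, O.IsUpperEnv u v w) ∧ (∀ u v, ∃ w, O.IsLowerEnv u v w)

namespace TwoOrders

variable {G : Type*} [AddCommGroup G] (O : TwoOrders G)

theorem le_iff_of_sub_eq {u v u' v' : G} (h : v - u = v' - u') : O.le u v ↔ O.le u' v' := by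
  have key : ∀ {a b c d : G}, b - a = d - c → O.le a b → O.le c d := fun {a b c d} e hab => by
    have hcd := O.add_le_add a b (c - a) hab
    rwa [add_sub_cancel, add_sub_left_comm, e, add_sub_cancel] at hcd
  exact ⟨key h, key h.symm⟩

theorem sle_iff_of_sub_eq {u v u' v' : G} (h : v - u = v' - u') : O.sle u v ↔ O.sle u' v' := by
  have key : ∀ {a b c d : G}, b - a = d - c → O.sle a b → O.sle c d := fun {a b c d} e hab => by
    have hcd := O.add_sle_add a b (c - a) hab
    rwa [add_sub_cancel, add_sub_left_comm, e, add_sub_cancel] at hcd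
  exact ⟨key h, key h.symm⟩

theorem IsUpperEnv.unique {O : TwoOrders G} {u v a b : G} (ha : O.IsUpperEnv u v a)
    (hb : O.IsUpperEnv u v b) : a = b :=
  O.le_antisymm _ _ (ha.2.2 b hb.1 hb.2.1) (hb.2.2 a ha.1 ha.2.1)

theorem IsLowerEnv.unique {O : TwoOrders G} {u v a b : G} (ha : O.IsLowerEnv u v a)
    (hb : O.IsLowerEnv u v b) : a = b :=
  O.le_antisymm _ _ (hb.2.2 a ha.1 ha.2.1) (ha.2.2 b hb.1 hb.2.1)

theorem isUpperEnv_iff_isLowerEnv {u v w : G} :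
    O.IsUpperEnv u v w ↔ O.IsLowerEnv v u (u + v - w) := by
  have hs : ∀ z, O.sle u z ↔ O.sle (u + v - z) v := fun z => O.sle_iff_of_sub_eq (by abel)
  have hl : ∀ z, O.le v z ↔ O.le (u + v - z) u := fun z => O.le_iff_of_sub_eq (by abel)
  have hw : ∀ z, O.le w z ↔ O.le (u + v - z) (u + v - w) :=
    fun z => O.le_iff_of_sub_eq (by abel)
  simp only [IsUpperEnv, IsLowerEnv, hs, hl, hw]
  rw [(Equiv.subLeft (u + v)).forall_congr_left]
  simp

theorem isMLG_iff_forall_exists_isUpperEnv :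
    O.IsMLG ↔ ∀ u v, ∃ w, O.IsUpperEnv u v w :=
  ⟨fun h => h.1, fun h => ⟨h, fun u v =>
    let ⟨_, hw⟩ := h v u
    ⟨_, O.isUpperEnv_iff_isLowerEnv.1 hw⟩⟩⟩

theorem isUpperEnv_add_right_iff {x y m : G} :
    O.IsUpperEnv x y (m + x) ↔ (O.sle 0 m ∧ O.le y (m + x)) ∧
      ∀ z, (O.sle 0 z ∧ O.le y (z + x)) → O.le m z := by
  have hs : ∀ z, O.sle x (z + x) ↔ O.sle 0 z := fun z => O.sle_iff_of_sub_eq (by abel)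
  have hm : ∀ z, O.le (m + x) (z + x) ↔ O.le m z := fun z => O.le_iff_of_sub_eq (by abel)
  rw [IsUpperEnv, ← (Equiv.addRight x).forall_congr_right]
  simp only [Equiv.coe_addRight, hs, hm, and_assoc, and_imp]

theorem isUpperEnv_add_left_iff {x y r : G} :
    O.IsUpperEnv y x (r + x) ↔ (O.le 0 r ∧ O.sle y (r + x)) ∧
      ∀ z, (O.le 0 z ∧ O.sle y (z + x)) → O.le r z := by
  have hl : ∀ z, O.le x (z + x) ↔ O.le 0 z := fun z => O.le_iff_of_sub_eq (by abel)
  have hr : ∀ z, O.le (r + x) (z + x) ↔ O.le r z := fun z => O.le_iff_of_sub_eq (by abel)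
  rw [IsUpperEnv, ← (Equiv.addRight x).forall_congr_right]
  simp only [Equiv.coe_addRight, hl, hr]
  grind

theorem exists_isUpperEnv_iff_exists_add {u v : G} (x : G) :
    (∃ w, O.IsUpperEnv u v w) ↔ ∃ m, O.IsUpperEnv u v (m + x) :=
  (Equiv.addRight x).exists_congr_right.symm

theorem eq_sub_of_isUpperEnv_of_isLowerEnv {u v a b : G} (ha : O.IsUpperEnv u v a)
    (hb : O.IsLowerEnv v u b) : b = u + v - a :=
  hb.unique (O.isUpperEnv_iff_isLowerEnv.1 ha)

end TwoOrders

theorem mlg_characterization {G : Type*} [AddCommGroup G] (O : TwoOrders G) :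
    (O.IsMLG ↔
      (∀ x y : G, ∃ m, (O.sle 0 m ∧ O.le y (m + x)) ∧
        ∀ z, (O.sle 0 z ∧ O.le y (z + x)) → O.le m z)) ∧
    (O.IsMLG ↔
      (∀ x y : G, ∃ r, (O.le 0 r ∧ O.sle y (r + x)) ∧
        ∀ z, (O.le 0 z ∧ O.sle y (z + x)) → O.le r z)) ∧
    (∀ x y m a b : G,
      ((O.sle 0 m ∧ O.le y (m + x)) ∧ ∀ z, (O.sle 0 z ∧ O.le y (z + x)) → O.le m z) →
      O.IsUpperEnv x y a → O.IsLowerEnv y x b → m = a - x ∧ m = y - b) ∧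
    (∀ x y r c d : G,
      ((O.le 0 r ∧ O.sle y (r + x)) ∧ ∀ z, (O.le 0 z ∧ O.sle y (z + x)) → O.le r z) →
      O.IsUpperEnv y x c → O.IsLowerEnv x y d → r = c - x ∧ r = y - d) := by
  simp only [← O.isUpperEnv_add_right_iff, ← O.isUpperEnv_add_left_iff,
    ← O.exists_isUpperEnv_iff_exists_add]
  refine ⟨O.isMLG_iff_forall_exists_isUpperEnv,
    O.isMLG_iff_forall_exists_isUpperEnv.trans forall_comm, ?_, ?_⟩
  · intro x y m a b hm ha hb
    obtain rfl := ha.unique hm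
    obtain rfl := O.eq_sub_of_isUpperEnv_of_isLowerEnv hm hb
    constructor <;> abel
  · intro x y r c d hr hc hd
    obtain rfl := hc.unique hr
    obtain rfl := O.eq_sub_of_isUpperEnv_of_isLowerEnv hr hd
    constructor <;> abel
end

section
/- Let G be a mixed lattice group. Then the following are equivalent: (a) for all x, y ∈ G, if x ⩗ y = 0 then (m • x) ⩗ (n • y) = 0 for all positive natural numbers m, n; (b) for all x, y ∈ G and all positive natural numbers n, (n • x) ⩗ (n • y) = n • (x ⩗ y); (c) for all x, y ∈ G and all positive natural numbers n, (n • x) ⩖ (n • y) = n • (x ⩖ y). -/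
namespace TwoOrders

variable {G : Type*} [AddCommGroup G] (O : TwoOrders G)

theorem neg_le_neg {x y : G} (h : O.le x y) : O.le (-y) (-x) := by
  have h' := O.add_le_add _ _ (-x + -y) h
  rwa [show x + (-x + -y) = -y by abel, show y + (-x + -y) = -x by abel] at h'

theorem neg_sle_neg {x y : G} (h : O.sle x y) : O.sle (-y) (-x) := by
  have h' := O.add_sle_add _ _ (-x + -y) h
  rwa [show x + (-x + -y) = -y by abel, show y + (-x + -y) = -x by abel] at h'

theorem nsmul_le_nsmul_left {y : G} (hy : O.le 0 y) {n k : ℕ} (h : n ≤ k) :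
    O.le (n • y) (k • y) := by
  induction k, h using Nat.le_induction with
  | base => exact O.le_refl _
  | succ k _ ih =>
    have h' := O.add_le_add _ _ (k • y) hy
    rw [zero_add, ← succ_nsmul'] at h'
    exact O.le_trans _ _ _ ih h'

theorem nsmul_sle_nsmul_left {y : G} (hy : O.sle 0 y) {n k : ℕ} (h : n ≤ k) :
    O.sle (n • y) (k • y) := by
  induction k, h using Nat.le_induction with
  | base => exact O.sle_refl _
  | succ k _ ih =>
    have h' := O.add_sle_add _ _ (k • y) hy
    rw [zero_add, ← succ_nsmul'] at h'
    exact O.sle_trans _ _ _ ih h'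

variable {O}

theorem IsLowerEnv.add_right {u v w : G} (h : O.IsLowerEnv u v w) (a : G) :
    O.IsLowerEnv (u + a) (v + a) (w + a) := by
  refine ⟨O.add_sle_add _ _ _ h.1, O.add_le_add _ _ _ h.2.1, fun z hu hv => ?_⟩
  have hu' := O.add_sle_add _ _ (-a) hu
  have hv' := O.add_le_add _ _ (-a) hv
  rw [add_neg_cancel_right] at hu' hv'
  simpa using O.add_le_add _ _ a (h.2.2 _ hu' hv')

theorem IsLowerEnv.neg {u v w : G} (h : O.IsLowerEnv u v w) :
    O.IsUpperEnv (-u) (-v) (-w) := by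
  refine ⟨O.neg_sle_neg h.1, O.neg_le_neg h.2.1, fun z hu hv => ?_⟩
  have hu' := O.neg_sle_neg hu
  have hv' := O.neg_le_neg hv
  rw [neg_neg] at hu' hv'
  simpa using O.neg_le_neg (h.2.2 _ hu' hv')

theorem IsUpperEnv.neg {u v w : G} (h : O.IsUpperEnv u v w) :
    O.IsLowerEnv (-u) (-v) (-w) := by
  refine ⟨O.neg_sle_neg h.1, O.neg_le_neg h.2.1, fun z hu hv => ?_⟩
  have hu' := O.neg_sle_neg hu
  have hv' := O.neg_le_neg hv
  rw [neg_neg] at hu' hv'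
  simpa using O.neg_le_neg (h.2.2 _ hu' hv')

end TwoOrders

theorem smul_envelope_equivalences {G : Type*} [AddCommGroup G]
    (O : TwoOrders G) (hMLG : O.IsMLG) :
    ((∀ x y : G, O.IsLowerEnv x y 0 →
        ∀ m n : ℕ, 0 < m → 0 < n → O.IsLowerEnv (m • x) (n • y) 0) ↔
      (∀ (x y w : G), O.IsLowerEnv x y w →
        ∀ n : ℕ, 0 < n → O.IsLowerEnv (n • x) (n • y) (n • w))) ∧
    ((∀ (x y w : G), O.IsLowerEnv x y w →
        ∀ n : ℕ, 0 < n → O.IsLowerEnv (n • x) (n • y) (n • w)) ↔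
      (∀ (x y w : G), O.IsUpperEnv x y w →
        ∀ n : ℕ, 0 < n → O.IsUpperEnv (n • x) (n • y) (n • w))) := by
  refine ⟨⟨fun H x y w h n hn => ?_, fun H x y h m n hm _ => ?_⟩,
    ⟨fun H x y w h n hn => ?_, fun H x y w h n hn => ?_⟩⟩
  · have h' := h.add_right (-w)
    rw [add_neg_cancel] at h'
    simpa [nsmul_add] using (H _ _ h' n n hn hn).add_right (n • w)
  · have h' := H _ _ _ h (max m n) (lt_max_of_lt_left hm)
    rw [nsmul_zero] at h'
    have hx := O.nsmul_sle_nsmul_left h.1 (Nat.zero_le m)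
    have hy := O.nsmul_le_nsmul_left h.2.1 (Nat.zero_le n)
    rw [zero_nsmul] at hx hy
    exact ⟨hx, hy, fun z hzx hzy => h'.2.2 z
      (O.sle_trans _ _ _ hzx (O.nsmul_sle_nsmul_left h.1 (le_max_left m n)))
      (O.le_trans _ _ _ hzy (O.nsmul_le_nsmul_left h.2.1 (le_max_right m n)))⟩
  · simpa using (H _ _ _ h.neg n hn).neg
  · simpa using (H _ _ _ h.neg n hn).neg
end
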